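/- arXiv:2310.06163 — 2 statements merged into one kernel-verified Lean document; each statement's English description precedes it below -/
import Mathlib

section
/- Let F be a field, and let M = F[X]^r ⊕ ⨁_{i=1}^m F[X]/(X^{a_i}) and N = F[X]^s ⊕ ⨁_{i=1}^n F[X]/(X^{b_i}) be F[X]-modules with r,m,s,n ≥ 0 and all a_i, b_j ≥ 1. Suppose there exist F[X]-linear maps f : M → N and g : N → M with f ∘ g = X·id_N and g ∘ f = X·id_M. If a_1, …, a_m are all at least 2, then m ≤ n. -/
/-- The module `F[X]^r ⊕ ⨁_{i=1}^m F[X]/(X^{a_i})`. -/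
abbrev FXMod (F : Type*) [Field F] (r m : ℕ) (a : Fin m → ℕ) :=
  (Fin r → Polynomial F) ×
    (Π i : Fin m, Polynomial F ⧸ Ideal.span {(Polynomial.X : Polynomial F) ^ a i})

open Polynomial in
/-- Multiplication by `X ^ (a i - 1)` on each torsion summand, as a map from `(F[X]/(X))^m`. -/
noncomputable def socleMap (F : Type*) [Field F] (r m : ℕ) (a : Fin m → ℕ) (ha : ∀ i, 1 ≤ a i) :
    (Fin m → F[X] ⧸ Ideal.span {(X : F[X])}) →ₗ[F[X]] FXMod F r m a :=
  LinearMap.prod 0 <| LinearMap.pi fun i =>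
    (Submodule.mapQ (Ideal.span {(X : F[X])}) (Ideal.span {(X : F[X]) ^ a i})
      (LinearMap.lsmul F[X] F[X] (X ^ (a i - 1))) (by
        intro p hp
        obtain ⟨q, rfl⟩ := Ideal.mem_span_singleton.1 hp
        refine Ideal.mem_span_singleton.2 ⟨q, ?_⟩
        obtain ⟨k, hk⟩ := Nat.exists_eq_add_of_le' (ha i)
        simp only [hk, LinearMap.lsmul_apply, smul_eq_mul, Nat.add_sub_cancel]
        ring)).comp (LinearMap.proj i)

open Polynomial in
theorem socleMap_injective {F : Type*} [Field F] (r m : ℕ) (a : Fin m → ℕ) (ha : ∀ i, 1 ≤ a i) :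
    Function.Injective (socleMap F r m a ha) := by
  refine (injective_iff_map_eq_zero _).2 fun v hv => funext fun i => ?_
  choose p hp using fun j => Submodule.Quotient.mk_surjective _ (v j)
  obtain rfl : (fun j => Submodule.Quotient.mk (p j)) = v := funext hp
  have hi : (Submodule.Quotient.mk (X ^ (a i - 1) * p i) :
      F[X] ⧸ Ideal.span {(X : F[X]) ^ a i}) = 0 :=
    congrFun (congrArg Prod.snd hv) i
  rw [Submodule.Quotient.mk_eq_zero, Ideal.mem_span_singleton] at hi
  rw [Pi.zero_apply, Submodule.Quotient.mk_eq_zero, Ideal.mem_span_singleton]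
  obtain ⟨k, hk⟩ := Nat.exists_eq_add_of_le' (ha i)
  rw [hk, Nat.add_sub_cancel, pow_succ] at hi
  exact (mul_dvd_mul_iff_left (pow_ne_zero k X_ne_zero)).1 hi

open Polynomial in
theorem exists_eq_pow_mul_of_smul_eq_zero {F : Type*} [Field F] {r m : ℕ} {a : Fin m → ℕ}
    (ha : ∀ i, 1 ≤ a i) {y : FXMod F r m a} (hy : (X : F[X]) • y = 0) :
    y.1 = 0 ∧ ∃ p : Fin m → F[X], ∀ i, y.2 i = Submodule.Quotient.mk (X ^ (a i - 1) * p i) := by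
  constructor
  · exact (smul_eq_zero.1 (congrArg Prod.fst hy : (X : F[X]) • y.1 = 0)).resolve_left X_ne_zero
  · have h (i : Fin m) : ∃ p : F[X], y.2 i = Submodule.Quotient.mk (X ^ (a i - 1) * p) := by
      obtain ⟨q, hq⟩ := Submodule.Quotient.mk_surjective _ (y.2 i)
      have hi : (X : F[X]) • y.2 i = 0 := congrFun (congrArg Prod.snd hy) i
      obtain ⟨k, hk⟩ := Nat.exists_eq_add_of_le' (ha i)
      rw [← hq, ← Submodule.Quotient.mk_smul, Submodule.Quotient.mk_eq_zero,
        Ideal.mem_span_singleton, hk, pow_succ', smul_eq_mul] at hi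
      obtain ⟨p, rfl⟩ := (mul_dvd_mul_iff_left X_ne_zero).1 hi
      exact ⟨p, by rw [← hq, hk, Nat.add_sub_cancel]⟩
    choose p hp using h
    exact ⟨p, hp⟩

open Polynomial in
theorem range_socleMap {F : Type*} [Field F] (r m : ℕ) (a : Fin m → ℕ) (ha : ∀ i, 1 ≤ a i) :
    LinearMap.range (socleMap F r m a ha) =
      LinearMap.ker (LinearMap.lsmul F[X] (FXMod F r m a) X) := by
  apply le_antisymm
  · rintro _ ⟨v, rfl⟩
    have hv : (X : F[X]) • v = 0 := funext fun i => by
      obtain ⟨p, hp⟩ := Submodule.Quotient.mk_surjective _ (v i)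
      rw [Pi.smul_apply, ← hp, ← Submodule.Quotient.mk_smul, Pi.zero_apply,
        Submodule.Quotient.mk_eq_zero, Ideal.mem_span_singleton]
      exact dvd_mul_right _ _
    rw [LinearMap.mem_ker, LinearMap.lsmul_apply, ← map_smul, hv, map_zero]
  · intro y hy
    obtain ⟨h₁, p, hp⟩ := exists_eq_pow_mul_of_smul_eq_zero ha hy
    refine ⟨fun i => Submodule.Quotient.mk (p i), Prod.ext h₁.symm (funext fun i => ?_)⟩
    rw [hp]
    rfl

open Polynomial in
theorem length_ker_lsmul_X {F : Type*} [Field F] (r m : ℕ) (a : Fin m → ℕ) (ha : ∀ i, 1 ≤ a i) :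
    Module.length F[X] (LinearMap.ker (LinearMap.lsmul F[X] (FXMod F r m a) X)) = m := by
  have : (Ideal.span {(X : F[X])}).IsMaximal :=
    PrincipalIdealRing.isMaximal_of_irreducible irreducible_X
  have : IsSimpleModule F[X] (F[X] ⧸ Ideal.span {(X : F[X])}) :=
    isSimpleModule_iff_isCoatom.2 this.out
  rw [← range_socleMap r m a ha,
    ← (LinearEquiv.ofInjective _ (socleMap_injective r m a ha)).length_eq,
    Module.length_pi_of_fintype]
  simp [Module.length_eq_one]

section Length

variable {R M N : Type*} [CommRing R] [AddCommGroup M] [Module R M] [AddCommGroup N] [Module R N]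

theorem Submodule.length_mono {p q : Submodule R M} (h : p ≤ q) :
    Module.length R p ≤ Module.length R q :=
  Module.length_le_of_injective (Submodule.inclusion h) (Submodule.inclusion_injective h)

theorem Submodule.length_eq_inf_ker_add_map (p : Submodule R M) (f : M →ₗ[R] N) :
    Module.length R p =
      Module.length R (p ⊓ LinearMap.ker f : Submodule R M) + Module.length R (p.map f) := by
  refine Module.length_eq_add_of_exact (Submodule.inclusion inf_le_left)
    (f.submoduleMap p) (Submodule.inclusion_injective _) (f.submoduleMap_surjective p) ?_
  intro x
  constructor
  · intro hx
    exact ⟨⟨x, x.2, congrArg Subtype.val hx⟩, rfl⟩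
  · rintro ⟨y, rfl⟩
    exact Subtype.ext y.2.2

/-- If `g ∘ f` is multiplication by `x` and every element of `M` killed by `x` is a
multiple of `x`, then the `x`-torsion of `M` is at most as long as that of `N`. -/
theorem length_ker_lsmul_le {x : R} (f : M →ₗ[R] N) (g : N →ₗ[R] M)
    (hgf : ∀ y, g (f y) = x • y)
    (hx : LinearMap.ker (LinearMap.lsmul R M x) ≤ LinearMap.range (LinearMap.lsmul R M x)) :
    Module.length R (LinearMap.ker (LinearMap.lsmul R M x)) ≤
      Module.length R (LinearMap.ker (LinearMap.lsmul R N x)) := by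
  rw [Submodule.length_eq_inf_ker_add_map _ f,
    Submodule.length_eq_inf_ker_add_map (LinearMap.ker (LinearMap.lsmul R N x)) g, add_comm]
  refine add_le_add (Submodule.length_mono ?_) (Submodule.length_mono ?_)
  · rintro _ ⟨y, hy, rfl⟩
    have hy : x • y = 0 := hy
    refine ⟨?_, ?_⟩
    · change x • f y = 0
      rw [← map_smul, hy, map_zero]
    · change g (f y) = 0
      rw [hgf, hy]
  · rintro y ⟨hy, hfy⟩
    obtain ⟨z, rfl⟩ := hx hy
    refine ⟨f z, ?_, hgf z⟩
    change x • f z = 0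
    rw [← map_smul]
    exact hfy

end Length

theorem stmt3 {F : Type*} [Field F] (r m s n : ℕ) (a : Fin m → ℕ) (b : Fin n → ℕ)
    (ha : ∀ i, 2 ≤ a i) (hb : ∀ j, 1 ≤ b j)
    (f : FXMod F r m a →ₗ[Polynomial F] FXMod F s n b)
    (g : FXMod F s n b →ₗ[Polynomial F] FXMod F r m a)
    (hfg : ∀ y, f (g y) = (Polynomial.X : Polynomial F) • y)
    (hgf : ∀ x, g (f x) = (Polynomial.X : Polynomial F) • x) :
    m ≤ n := by
  have ha' (i : Fin m) : 1 ≤ a i := one_le_two.trans (ha i)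
  have h := length_ker_lsmul_le f g hgf ?_
  · rw [length_ker_lsmul_X r m a ha', length_ker_lsmul_X s n b hb] at h
    exact_mod_cast h
  · intro y hy
    obtain ⟨h₁, p, hp⟩ := exists_eq_pow_mul_of_smul_eq_zero ha' hy
    refine ⟨(0, fun i => Submodule.Quotient.mk (Polynomial.X ^ (a i - 2) * p i)),
      Prod.ext ((smul_zero _).trans h₁.symm) (funext fun i => ?_)⟩
    have h₂ := ha i
    rw [hp]
    change Submodule.Quotient.mk (Polynomial.X * (Polynomial.X ^ (a i - 2) * p i)) = _
    rw [← mul_assoc, ← pow_succ', show a i - 2 + 1 = a i - 1 by omega]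
end

section
/- Let F be a field and let M = F[X]^r ⊕ ⨁_{i=1}^m F[X]/(X^{a_i}) with all a_i ≥ 2, and N = F[X]^s ⊕ ⨁_{j=1}^n F[X]/(X^{b_j}) with all b_j ≥ 1. If there is an F[X]-module map h : M → M that factors as h = g ∘ f through N (i.e., h = g ∘ f for some F[X]-maps f : M → N, g : N → M) with h = X·id_M and f ∘ g = X·id_N, then the total X-torsion dimension satisfies: the number of torsion summands of M is at most the number of torsion summands of N. -/
section Torsion

variable {R : Type*} [CommRing R]

theorem length_eq_length_ker_add_length_range {M N : Type*} [AddCommGroup M] [AddCommGroup N]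
    [Module R M] [Module R N] (f : M →ₗ[R] N) :
    Module.length R M =
      Module.length R (LinearMap.ker f) + Module.length R (LinearMap.range f) :=
  Module.length_eq_add_of_exact (LinearMap.ker f).subtype f.rangeRestrict
    (Submodule.subtype_injective _) f.surjective_rangeRestrict
    (LinearMap.exact_iff.2 (by rw [LinearMap.ker_rangeRestrict, Submodule.range_subtype]))

/-- If `p` acts on `M` as `g ∘ f` and on `N` as `f ∘ g`, and the `p`-torsion of `M` is
contained in `p M`, then its length is at most that of the `p`-torsion of `N`. -/
theorem length_torsionBy_le_of_comp_eq_smul {M N : Type*} [AddCommGroup M] [AddCommGroup N]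
    [Module R M] [Module R N] (p : R) (f : M →ₗ[R] N) (g : N →ₗ[R] M)
    (hgf : ∀ x, g (f x) = p • x) (hfg : ∀ y, f (g y) = p • y)
    (hdiv : ∀ x : M, p • x = 0 → ∃ w, x = p • w) :
    Module.length R (Submodule.torsionBy R M p) ≤
      Module.length R (Submodule.torsionBy R N p) := by
  have hf (x : Submodule.torsionBy R M p) : f x ∈ LinearMap.ker g := by
    rw [LinearMap.mem_ker, hgf, (Submodule.mem_torsionBy_iff p x.1).1 x.2]
  have hg (y : Submodule.torsionBy R N p) : g y ∈ Submodule.torsionBy R M p := by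
    rw [Submodule.mem_torsionBy_iff, ← map_smul, (Submodule.mem_torsionBy_iff p y.1).1 y.2,
      map_zero]
  let f' : Submodule.torsionBy R M p →ₗ[R] LinearMap.ker g :=
    (f.comp (Submodule.subtype _)).codRestrict _ hf
  let g' : Submodule.torsionBy R N p →ₗ[R] Submodule.torsionBy R M p :=
    (g.comp (Submodule.subtype _)).codRestrict _ hg
  have hker_f : LinearMap.ker f' ≤ LinearMap.range g' := by
    intro x hx
    obtain ⟨w, hw⟩ := hdiv x ((Submodule.mem_torsionBy_iff p x.1).1 x.2)
    have hfx : f x = 0 := congrArg Subtype.val (LinearMap.mem_ker.1 hx)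
    refine ⟨⟨f w, ?_⟩, Subtype.ext ?_⟩
    · rw [Submodule.mem_torsionBy_iff, ← map_smul, ← hw, hfx]
    · exact (hgf w).trans hw.symm
  let e : LinearMap.ker g →ₗ[R] LinearMap.ker g' :=
    LinearMap.codRestrict _
      (LinearMap.codRestrict _ (LinearMap.ker g).subtype fun y => by
        rw [Submodule.mem_torsionBy_iff, ← hfg]
        simp)
      fun y => Subtype.ext y.2
  have he : Function.Injective e := fun y z h =>
    Subtype.ext (congrArg (fun t => (t.1.1 : N)) h)
  rw [length_eq_length_ker_add_length_range f', length_eq_length_ker_add_length_range g',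
    add_comm]
  exact add_le_add
    ((Module.length_le_of_injective _ (Submodule.subtype_injective _)).trans
      (Module.length_le_of_injective e he))
    (Module.length_le_of_injective _ (Submodule.inclusion_injective hker_f))

/-- The elements of `R / (p ^ (k + 1))` killed by `p` are the multiples of `p ^ k`. -/
theorem smul_mk_eq_zero_iff [IsDomain R] {p : R} (hp : p ≠ 0) (k : ℕ) (x : R) :
    p • (Ideal.Quotient.mk (Ideal.span {p ^ (k + 1)}) x) = 0 ↔ p ^ k ∣ x := by
  rw [← Ideal.Quotient.mk_eq_mk, ← Submodule.Quotient.mk_smul, Submodule.Quotient.mk_eq_zero,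
    Ideal.mem_span_singleton, smul_eq_mul, pow_succ', mul_dvd_mul_iff_left hp]

/-- Multiplication by `p ^ k` as a map `R / (p) → R / (p ^ (k + 1))`. -/
def quotientMulPow (p : R) (k : ℕ) :
    (R ⧸ Ideal.span {p}) →ₗ[R] R ⧸ Ideal.span {p ^ (k + 1)} :=
  Submodule.mapQ _ _ (LinearMap.mulLeft R (p ^ k)) fun x hx => by
    rw [Submodule.mem_comap, LinearMap.mulLeft_apply, Ideal.mem_span_singleton, pow_succ]
    exact mul_dvd_mul_left _ (Ideal.mem_span_singleton.1 hx)

theorem quotientMulPow_mk (p : R) (k : ℕ) (x : R) :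
    quotientMulPow p k (Ideal.Quotient.mk _ x) = Ideal.Quotient.mk _ (p ^ k * x) := rfl

theorem quotientMulPow_injective [IsDomain R] {p : R} (hp : p ≠ 0) (k : ℕ) :
    Function.Injective (quotientMulPow p k) := by
  rw [injective_iff_map_eq_zero]
  intro x
  obtain ⟨x, rfl⟩ := Ideal.Quotient.mk_surjective x
  rw [quotientMulPow_mk, Ideal.Quotient.eq_zero_iff_mem, Ideal.Quotient.eq_zero_iff_mem,
    Ideal.mem_span_singleton, Ideal.mem_span_singleton, pow_succ,
    mul_dvd_mul_iff_left (pow_ne_zero k hp)]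
  exact id

theorem range_quotientMulPow [IsDomain R] {p : R} (hp : p ≠ 0) (k : ℕ) :
    LinearMap.range (quotientMulPow p k) = Submodule.torsionBy R _ p := by
  ext x
  obtain ⟨x, rfl⟩ := Ideal.Quotient.mk_surjective x
  rw [Submodule.mem_torsionBy_iff, smul_mk_eq_zero_iff hp]
  constructor
  · rintro ⟨y, hy⟩
    obtain ⟨y, rfl⟩ := Ideal.Quotient.mk_surjective y
    rw [← smul_mk_eq_zero_iff hp, ← hy, quotientMulPow_mk, smul_mk_eq_zero_iff hp]
    exact dvd_mul_right _ _
  · rintro ⟨y, rfl⟩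
    exact ⟨Ideal.Quotient.mk _ y, rfl⟩

theorem length_torsionBy_free_prod_pi_quotient [IsDomain R] [IsPrincipalIdealRing R] {p : R}
    (hp : Irreducible p) (r m : ℕ) (k : Fin m → ℕ) :
    Module.length R (Submodule.torsionBy R
      ((Fin r → R) × (Π i : Fin m, R ⧸ Ideal.span {p ^ (k i + 1)})) p) = m := by
  let φ : (Fin m → R ⧸ Ideal.span {p}) →ₗ[R]
      (Fin r → R) × (Π i : Fin m, R ⧸ Ideal.span {p ^ (k i + 1)}) :=
    (LinearMap.inr R _ _).comp
      (LinearMap.pi fun i => (quotientMulPow p (k i)).comp (LinearMap.proj i))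
  have hφ : Function.Injective φ := fun v w h => funext fun i =>
    quotientMulPow_injective hp.ne_zero (k i) (congrFun (congrArg Prod.snd h) i)
  have hrange : LinearMap.range φ = Submodule.torsionBy R _ p := by
    ext x
    rw [Submodule.mem_torsionBy_iff]
    constructor
    · rintro ⟨v, rfl⟩
      refine Prod.ext (smul_zero p) (funext fun i => ?_)
      exact (Submodule.mem_torsionBy_iff p _).1
        ((range_quotientMulPow hp.ne_zero (k i)).le ⟨v i, rfl⟩)
    · intro hx
      have hsnd (i) : ∃ y, quotientMulPow p (k i) y = x.2 i :=
        (range_quotientMulPow hp.ne_zero (k i)).ge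
          ((Submodule.mem_torsionBy_iff p _).2 (congrFun (congrArg Prod.snd hx) i))
      choose v hv using hsnd
      refine ⟨v, Prod.ext (funext fun i => ?_) (funext hv)⟩
      have hfst : p * x.1 i = 0 := congrFun (congrArg Prod.fst hx) i
      exact ((mul_eq_zero.1 hfst).resolve_left hp.ne_zero).symm
  have : (Ideal.span {p}).IsMaximal := PrincipalIdealRing.isMaximal_of_irreducible hp
  have : IsSimpleModule R (R ⧸ Ideal.span {p}) := isSimpleModule_iff_isCoatom.2 this.out
  rw [← hrange, ← (LinearEquiv.ofInjective φ hφ).length_eq, Module.length_pi_of_fintype]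
  simp [Module.length_eq_one]

theorem exists_eq_smul_of_smul_eq_zero [IsDomain R] {p : R} (hp : p ≠ 0) {r m : ℕ}
    (k : Fin m → ℕ) (hk : ∀ i, 1 ≤ k i)
    (x : (Fin r → R) × (Π i : Fin m, R ⧸ Ideal.span {p ^ (k i + 1)})) (hx : p • x = 0) :
    ∃ w, x = p • w := by
  have hsnd (i) : ∃ w, x.2 i = p • w := by
    have hi : p • x.2 i = 0 := congrFun (congrArg Prod.snd hx) i
    obtain ⟨y, hy⟩ := Ideal.Quotient.mk_surjective (x.2 i)
    rw [← hy, smul_mk_eq_zero_iff hp] at hi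
    obtain ⟨z, rfl⟩ := (dvd_pow_self p (Nat.one_le_iff_ne_zero.1 (hk i))).trans hi
    exact ⟨Ideal.Quotient.mk _ z, hy.symm⟩
  choose w hw using hsnd
  refine ⟨(0, w), Prod.ext (funext fun i => ?_) (funext hw)⟩
  have hfst : p * x.1 i = 0 := congrFun (congrArg Prod.fst hx) i
  exact ((mul_eq_zero.1 hfst).resolve_left hp).trans (mul_zero p).symm

end Torsion

theorem stmt10 {F : Type*} [Field F] (r m s n : ℕ) (a : Fin m → ℕ) (b : Fin n → ℕ)
    (ha : ∀ i, 2 ≤ a i) (hb : ∀ j, 1 ≤ b j)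
    (h : FXMod F r m a →ₗ[Polynomial F] FXMod F r m a)
    (f : FXMod F r m a →ₗ[Polynomial F] FXMod F s n b)
    (g : FXMod F s n b →ₗ[Polynomial F] FXMod F r m a)
    (hfact : h = g.comp f)
    (hX : ∀ x, h x = (Polynomial.X : Polynomial F) • x)
    (hfg : ∀ y, f (g y) = (Polynomial.X : Polynomial F) • y) :
    m ≤ n := by
  obtain ⟨k, rfl⟩ : ∃ k : Fin m → ℕ, a = fun i => k i + 1 :=
    ⟨fun i => a i - 1, funext fun i => (Nat.sub_add_cancel (one_le_two.trans (ha i))).symm⟩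
  obtain ⟨l, rfl⟩ : ∃ l : Fin n → ℕ, b = fun j => l j + 1 :=
    ⟨fun j => b j - 1, funext fun j => (Nat.sub_add_cancel (hb j)).symm⟩
  have hle := length_torsionBy_le_of_comp_eq_smul Polynomial.X f g
    (fun x => by rw [← hX, hfact, LinearMap.comp_apply]) hfg
    (exists_eq_smul_of_smul_eq_zero Polynomial.X_ne_zero k fun i => Nat.le_of_succ_le_succ (ha i))
  rw [length_torsionBy_free_prod_pi_quotient Polynomial.irreducible_X,
    length_torsionBy_free_prod_pi_quotient Polynomial.irreducible_X] at hle
  exact_mod_cast hle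
end
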